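/- arXiv:1708.09565 — 3 statements merged into one kernel-verified Lean document; each statement's English description precedes it below -/
import Mathlib

section
/- Let p be a prime, n ≥ 1, and 0 ≤ i ≤ n−2. Write g_i for the number of (i+1)-element sets of distinct one-dimensional subspaces of (F_p)^n whose sum has dimension i+1. Then (p−1) · (i+2) · g_{i+1} = (p^n − p^{i+1}) · g_i. -/
/-- `g_i`, the number of `i`-dimensional simplices of `K(F_p^n)`, i.e. the number of
`(i+1)`-element sets of distinct one-dimensional subspaces of `(F_p)^n` whose sum has
dimension `i+1`. -/
noncomputable def gK (p n i : ℕ) : ℕ :=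
  Nat.card {σ : Finset (Submodule (ZMod p) (Fin n → ZMod p)) // σ.card = i + 1 ∧
    (∀ L ∈ σ, Module.finrank (ZMod p) L = 1) ∧
    Module.finrank (ZMod p) (σ.sup id : Submodule (ZMod p) (Fin n → ZMod p)) = i + 1}

section LineSets

variable {K V : Type*} [Field K] [AddCommGroup V] [Module K V]

/-- A set of `k` distinct lines of `V` whose sum has dimension `k`. -/
def IsIndepLineSet (K : Type*) {V : Type*} [Field K] [AddCommGroup V] [Module K V]
    (k : ℕ) (σ : Finset (Submodule K V)) : Prop :=
  σ.card = k ∧ (∀ L ∈ σ, Module.finrank K L = 1) ∧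
    Module.finrank K (σ.sup id : Submodule K V) = k

lemma finrank_finset_sup_le_card [FiniteDimensional K V] (σ : Finset (Submodule K V))
    (h : ∀ L ∈ σ, Module.finrank K L = 1) :
    Module.finrank K (σ.sup id : Submodule K V) ≤ σ.card := by
  classical
  induction σ using Finset.induction_on with
  | empty => simp
  | insert L σ hL ih =>
    rw [Finset.sup_insert, Finset.card_insert_of_notMem hL, id]
    have h₁ := Submodule.finrank_add_le_finrank_add_finrank L (σ.sup id)
    have h₂ := h L (Finset.mem_insert_self _ _)
    have h₃ := ih fun M hM => h M (Finset.mem_insert_of_mem hM)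
    omega

lemma span_singleton_notMem_of_notMem_sup {σ : Finset (Submodule K V)} {v : V}
    (hv : v ∉ σ.sup id) : Submodule.span K {v} ∉ σ := fun h =>
  hv ((Finset.le_sup (f := id) h : Submodule.span K {v} ≤ σ.sup id)
    (Submodule.mem_span_singleton_self v))

open Classical in
lemma IsIndepLineSet.insert_span_singleton [FiniteDimensional K V] {k : ℕ}
    {σ : Finset (Submodule K V)} (hσ : IsIndepLineSet K k σ) {v : V} (hv : v ∉ σ.sup id) :
    IsIndepLineSet K (k + 1) (insert (Submodule.span K {v}) σ) := by
  obtain ⟨hcard, hline, hrank⟩ := hσ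
  have hv0 : v ≠ 0 := fun h => hv (h ▸ zero_mem _)
  have hspan : Module.finrank K (Submodule.span K {v}) = 1 := finrank_span_singleton hv0
  refine ⟨?_, ?_, ?_⟩
  · rw [Finset.card_insert_of_notMem (span_singleton_notMem_of_notMem_sup hv), hcard]
  · intro L hL
    rcases Finset.mem_insert.1 hL with rfl | hL
    exacts [hspan, hline L hL]
  · have hdisj : Disjoint (σ.sup id) (Submodule.span K {v}) :=
      (Submodule.disjoint_span_singleton' hv0).2 hv
    have h := Submodule.finrank_sup_add_finrank_inf_eq (Submodule.span K {v}) (σ.sup id)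
    rw [hdisj.symm.eq_bot, finrank_bot] at h
    rw [Finset.sup_insert, id]
    omega

open Classical in
lemma IsIndepLineSet.erase_span_singleton [FiniteDimensional K V] {k : ℕ}
    {τ : Finset (Submodule K V)} (hτ : IsIndepLineSet K (k + 1) τ) {v : V}
    (hv : Submodule.span K {v} ∈ τ) :
    IsIndepLineSet K k (τ.erase (Submodule.span K {v})) ∧
      v ∉ (τ.erase (Submodule.span K {v})).sup id := by
  obtain ⟨hcard, hline, hrank⟩ := hτ
  have hcard' : (τ.erase (Submodule.span K {v})).card = k := by
    rw [Finset.card_erase_of_mem hv, hcard, Nat.add_sub_cancel]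
  have hline' : ∀ L ∈ τ.erase (Submodule.span K {v}), Module.finrank K L = 1 :=
    fun L hL => hline L (Finset.mem_of_mem_erase hL)
  have hle := finrank_finset_sup_le_card _ hline'
  rw [← Finset.insert_erase hv, Finset.sup_insert, id] at hrank
  have hadd := Submodule.finrank_add_le_finrank_add_finrank (Submodule.span K {v})
    ((τ.erase (Submodule.span K {v})).sup id)
  have hspan := hline _ hv
  refine ⟨⟨hcard', hline', by omega⟩, fun hmem => ?_⟩
  rw [sup_eq_right.2 ((Submodule.span_singleton_le_iff_mem _ _).2 hmem)] at hrank
  omega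

variable [Fintype K] [Fintype V]

open Classical in
lemma card_filter_span_singleton_eq {L : Submodule K V} (hL : Module.finrank K L = 1) :
    (Finset.univ.filter fun v : V => v ≠ 0 ∧ Submodule.span K {v} = L).card =
      Fintype.card K - 1 := by
  have h : (Finset.univ.filter fun v : V => v ≠ 0 ∧ Submodule.span K {v} = L) =
      (Finset.univ.filter fun v : V => v ∈ L).erase 0 := by
    ext v
    simp only [Finset.mem_filter, Finset.mem_univ, true_and, Finset.mem_erase]
    refine and_congr_right fun hv => ⟨fun h => h ▸ Submodule.mem_span_singleton_self v, fun h => ?_⟩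
    refine Submodule.eq_of_le_of_finrank_eq ((Submodule.span_singleton_le_iff_mem _ _).2 h) ?_
    rw [hL, finrank_span_singleton hv]
  rw [h, Finset.card_erase_of_mem (by simp), ← Fintype.card_subtype]
  congr 1
  have := Module.card_eq_pow_finrank (K := K) (V := L)
  rw [hL, pow_one] at this
  exact (Fintype.card_congr (Equiv.refl _)).trans this

open Classical in
lemma card_filter_span_singleton_mem {τ : Finset (Submodule K V)}
    (hτ : ∀ L ∈ τ, Module.finrank K L = 1) :
    (Finset.univ.filter fun v : V => v ≠ 0 ∧ Submodule.span K {v} ∈ τ).card =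
      τ.card * (Fintype.card K - 1) := by
  rw [Finset.card_eq_sum_card_fiberwise (f := fun v => Submodule.span K {v}) (t := τ)
    (fun v hv => (Finset.mem_filter.1 hv).2.2), ← smul_eq_mul, ← Finset.sum_const]
  refine Finset.sum_congr rfl fun L hL => ?_
  rw [← card_filter_span_singleton_eq (hτ L hL), Finset.filter_filter]
  congr 1
  ext v
  simp only [Finset.mem_filter, Finset.mem_univ, true_and]
  constructor
  · rintro ⟨⟨h₀, -⟩, h⟩
    exact ⟨h₀, h⟩
  · rintro ⟨h₀, h⟩
    exact ⟨⟨h₀, h ▸ hL⟩, h⟩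

open Classical in
lemma card_filter_notMem (W : Submodule K V) :
    (Finset.univ.filter fun v : V => v ∉ W).card =
      Fintype.card K ^ Module.finrank K V - Fintype.card K ^ Module.finrank K W := by
  rw [← Module.card_eq_pow_finrank (K := K) (V := V), ← Module.card_eq_pow_finrank (K := K) (V := W),
    ← Finset.compl_filter, Finset.card_compl, ← Fintype.card_subtype]

theorem card_isIndepLineSet_succ (k : ℕ) :
    (Fintype.card K - 1) * (k + 1) *
        Nat.card {τ : Finset (Submodule K V) // IsIndepLineSet K (k + 1) τ} =
      (Fintype.card K ^ Module.finrank K V - Fintype.card K ^ k) *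
        Nat.card {σ : Finset (Submodule K V) // IsIndepLineSet K k σ} := by
  classical
  have := Fintype.ofFinite (Submodule K V)
  simp only [Nat.card_eq_fintype_card, Fintype.card_subtype]
  have key : ((Finset.univ.filter (IsIndepLineSet K (V := V) (k + 1))).sigma fun τ =>
        Finset.univ.filter fun v : V => v ≠ 0 ∧ Submodule.span K {v} ∈ τ).card =
      ((Finset.univ.filter (IsIndepLineSet K (V := V) k)).sigma fun σ =>
        Finset.univ.filter fun v : V => v ∉ σ.sup id).card := by
    refine Finset.card_bij'
      (fun x _ => ⟨x.1.erase (Submodule.span K {x.2}), x.2⟩)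
      (fun x _ => ⟨insert (Submodule.span K {x.2}) x.1, x.2⟩) ?_ ?_ ?_ ?_
    · rintro ⟨τ, v⟩ h
      simp only [Finset.mem_sigma, Finset.mem_filter, Finset.mem_univ, true_and] at h ⊢
      exact h.1.erase_span_singleton h.2.2
    · rintro ⟨σ, v⟩ h
      simp only [Finset.mem_sigma, Finset.mem_filter, Finset.mem_univ, true_and] at h ⊢
      exact ⟨h.1.insert_span_singleton h.2, fun h₀ => h.2 (h₀ ▸ zero_mem _),
        Finset.mem_insert_self _ _⟩
    · rintro ⟨τ, v⟩ h
      simp only [Finset.mem_sigma, Finset.mem_filter, Finset.mem_univ, true_and] at h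
      simp only [Finset.insert_erase h.2.2]
    · rintro ⟨σ, v⟩ h
      simp only [Finset.mem_sigma, Finset.mem_filter, Finset.mem_univ, true_and] at h
      simp only [Finset.erase_insert (span_singleton_notMem_of_notMem_sup h.2)]
  rw [Finset.card_sigma, Finset.card_sigma,
    Finset.sum_congr rfl (g := fun _ => (k + 1) * (Fintype.card K - 1)) fun τ hτ => by
      have h := (Finset.mem_filter.1 hτ).2
      rw [card_filter_span_singleton_mem h.2.1, h.1],
    Finset.sum_congr rfl (s₂ := Finset.univ.filter (IsIndepLineSet K (V := V) k))
      (g := fun _ => Fintype.card K ^ Module.finrank K V - Fintype.card K ^ k) fun σ hσ => by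
      have h := (Finset.mem_filter.1 hσ).2
      rw [card_filter_notMem, h.2.2],
    Finset.sum_const, Finset.sum_const, smul_eq_mul, smul_eq_mul] at key
  rw [mul_comm (Fintype.card K - 1), mul_comm, key, mul_comm]

end LineSets

/-- The recurrence `(p−1)·(i+2)·g_{i+1} = (p^n − p^{i+1})·g_i` for the f-vector of
`K(F_p^n)`. -/
theorem fvector_K_Fp_recurrence (p n i : ℕ) (hp : p.Prime) (hn : 1 ≤ n) (hi : i ≤ n - 2) :
    (p - 1) * (i + 2) * gK p n (i + 1) = (p ^ n - p ^ (i + 1)) * gK p n i := by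
  have : Fact p.Prime := ⟨hp⟩
  have h := card_isIndepLineSet_succ (K := ZMod p) (V := Fin n → ZMod p) (i + 1)
  rw [ZMod.card, Module.finrank_fin_fun] at h
  exact h
end

section
/- Let p and q be primes and n a positive integer. Define ς_{p,q}(n) to be the least positive integer r such that there exists a nondegenerate simplicial map from K(F_p^n) to K(F_q^r) (a function on one-dimensional subspaces sending every set of k distinct lines whose sum has dimension k injectively to such a set in (F_q)^r). Then ς_{p,q}(n) is well defined and satisfies ⌈log_q((q−1)·(p^n−1)/(p−1) + 1)⌉ ≤ ς_{p,q}(n) ≤ (p^n − 1)/(p − 1). In particular (p^n−1)/(p−1) ≤ (q^{ς_{p,q}(n)} − 1)/(q−1), and a nondegenerate map into K(F_q^{(p^n−1)/(p−1)}) exists. -/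
/-- `f` is a nondegenerate simplicial map from `K(F_p^m)` to `K(F_q^n)`: every set of `k`
distinct lines of `(F_p)^m` whose sum has dimension `k` is mapped injectively to a set of
`k` distinct lines of `(F_q)^n` whose sum has dimension `k`. -/
def IsNondegMapK (p q m n : ℕ)
    (f : {L : Submodule (ZMod p) (Fin m → ZMod p) // Module.finrank (ZMod p) L = 1} →
         {L : Submodule (ZMod q) (Fin n → ZMod q) // Module.finrank (ZMod q) L = 1}) : Prop :=
  ∀ σ : Finset {L : Submodule (ZMod p) (Fin m → ZMod p) // Module.finrank (ZMod p) L = 1},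
    Module.finrank (ZMod p) ↥(σ.sup (fun L => L.val)) = σ.card →
      Set.InjOn f ↑σ ∧
      Module.finrank (ZMod q) ↥(σ.sup (fun L => (f L).val)) = σ.card

theorem card_lines (p n : ℕ) (hp : p.Prime) :
    Nat.card {L : Submodule (ZMod p) (Fin n → ZMod p) // Module.finrank (ZMod p) L = 1} =
      (p ^ n - 1) / (p - 1) := by
  have := Fact.mk hp
  rw [← Nat.card_congr (Projectivization.equivSubmodule (ZMod p) (Fin n → ZMod p)),
    Projectivization.card_of_finrank (ZMod p) (Fin n → ZMod p) (n := n) (by simp),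
    Nat.card_zmod, Nat.geomSum_eq hp.two_le]

/-- Two distinct lines span a plane. -/
theorem finrank_sup_of_ne_of_finrank_eq_one {K V : Type*} [Field K] [AddCommGroup V] [Module K V]
    [FiniteDimensional K V] {L M : Submodule K V} (hL : Module.finrank K L = 1)
    (hM : Module.finrank K M = 1) (h : L ≠ M) : Module.finrank K ↥(L ⊔ M) = 2 := by
  have hsum := Submodule.finrank_sup_add_finrank_inf_eq L M
  have hlt : L ⊓ M < L := by
    refine lt_of_le_of_ne inf_le_left fun he => h ?_
    exact Submodule.eq_of_le_of_finrank_eq (inf_eq_left.mp he) (hL.trans hM.symm)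
  have := Submodule.finrank_lt_finrank_of_lt hlt
  omega

theorem IsNondegMapK.injective {p q m n : ℕ} (hp : p.Prime)
    {f : {L : Submodule (ZMod p) (Fin m → ZMod p) // Module.finrank (ZMod p) L = 1} →
         {L : Submodule (ZMod q) (Fin n → ZMod q) // Module.finrank (ZMod q) L = 1}}
    (hf : IsNondegMapK p q m n f) : Function.Injective f := by
  classical
  have := Fact.mk hp
  intro L M hLM
  by_contra hne
  have h2 := hf {L, M} (by
    rw [Finset.card_pair hne, Finset.sup_insert, Finset.sup_singleton]
    exact finrank_sup_of_ne_of_finrank_eq_one L.2 M.2 fun h => hne (Subtype.ext h))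
  exact hne (h2.1 (by simp) (by simp) hLM)

theorem IsNondegMapK.card_le {p q m n : ℕ} (hp : p.Prime) (hq : q.Prime)
    {f : {L : Submodule (ZMod p) (Fin m → ZMod p) // Module.finrank (ZMod p) L = 1} →
         {L : Submodule (ZMod q) (Fin n → ZMod q) // Module.finrank (ZMod q) L = 1}}
    (hf : IsNondegMapK p q m n f) :
    (p ^ m - 1) / (p - 1) ≤ (q ^ n - 1) / (q - 1) := by
  have := Fact.mk hq
  rw [← card_lines p m hp, ← card_lines q n hq]
  exact Nat.card_le_card_of_injective f (hf.injective hp)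

/-- Sending the lines of `(F_p)^m` to distinct coordinate axes is nondegenerate. -/
theorem exists_isNondegMapK_of_card (p q m : ℕ) (hp : p.Prime) (hq : q.Prime) :
    ∃ f, IsNondegMapK p q m ((p ^ m - 1) / (p - 1)) f := by
  classical
  have := Fact.mk hp
  have := Fact.mk hq
  let e := Finite.equivFinOfCardEq (card_lines p m hp)
  let b := Pi.basisFun (ZMod q) (Fin ((p ^ m - 1) / (p - 1)))
  let f : {L : Submodule (ZMod p) (Fin m → ZMod p) // Module.finrank (ZMod p) L = 1} →
      {L : Submodule (ZMod q) (Fin ((p ^ m - 1) / (p - 1)) → ZMod q) //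
        Module.finrank (ZMod q) L = 1} :=
    fun L => ⟨Submodule.span (ZMod q) {b (e L)}, finrank_span_singleton (b.ne_zero _)⟩
  have key (σ : Finset {L : Submodule (ZMod p) (Fin m → ZMod p) //
      Module.finrank (ZMod p) L = 1}) :
      Module.finrank (ZMod q) ↥(σ.sup (fun L => (f L).val)) = σ.card := by
    have hli : LinearIndependent (ZMod q) (fun L : σ => b (e L)) :=
      b.linearIndependent.comp (fun L : σ => e L) (e.injective.comp Subtype.val_injective)
    have hsup : σ.sup (fun L => (f L).val) =
        Submodule.span (ZMod q) (Set.range fun L : σ => b (e L)) := by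
      rw [Submodule.span_range_eq_iSup, Finset.sup_eq_iSup]
      exact iSup_subtype'
    rw [hsup, finrank_span_eq_card hli, Fintype.card_coe]
  refine ⟨f, fun σ _ => ⟨Function.Injective.injOn fun L M hLM => ?_, key σ⟩⟩
  by_contra hne
  have h2 := key {L, M}
  rw [Finset.card_pair hne, Finset.sup_insert, Finset.sup_singleton, hLM, sup_idem, (f M).2] at h2
  omega

/-- `ς_{p,q}(n)`, the least positive `r` admitting a nondegenerate simplicial map from
`K(F_p^n)` to `K(F_q^r)`, is well defined (a nondegenerate map into
`K(F_q^{(p^n−1)/(p−1)})` exists) and satisfies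
`⌈log_q((q−1)(p^n−1)/(p−1) + 1)⌉ ≤ ς_{p,q}(n) ≤ (p^n−1)/(p−1)`; in particular
`(p^n−1)/(p−1) ≤ (q^{ς_{p,q}(n)} − 1)/(q−1)`. -/
theorem sigma_pq_bounds (p q n : ℕ) (hp : p.Prime) (hq : q.Prime) (hn : 0 < n) :
    (∃ f, IsNondegMapK p q n ((p ^ n - 1) / (p - 1)) f) ∧
    Nat.clog q ((q - 1) * ((p ^ n - 1) / (p - 1)) + 1) ≤
      sInf {r : ℕ | 0 < r ∧ ∃ f, IsNondegMapK p q n r f} ∧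
    sInf {r : ℕ | 0 < r ∧ ∃ f, IsNondegMapK p q n r f} ≤ (p ^ n - 1) / (p - 1) ∧
    (p ^ n - 1) / (p - 1) ≤
      (q ^ sInf {r : ℕ | 0 < r ∧ ∃ f, IsNondegMapK p q n r f} - 1) / (q - 1) := by
  have hex := exists_isNondegMapK_of_card p q n hp hq
  have hpos : 0 < (p ^ n - 1) / (p - 1) := by
    have hp2 := hp.two_le
    exact Nat.div_pos (Nat.sub_le_sub_right (Nat.le_self_pow hn.ne' p) 1) (by omega)
  have hmem : (p ^ n - 1) / (p - 1) ∈ {r : ℕ | 0 < r ∧ ∃ f, IsNondegMapK p q n r f} :=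
    ⟨hpos, hex⟩
  obtain ⟨-, f, hf⟩ := Nat.sInf_mem ⟨_, hmem⟩
  have hle := hf.card_le hp hq
  refine ⟨hex, ?_, Nat.sInf_le hmem, hle⟩
  rw [Nat.clog_le_iff_le_pow hq.one_lt]
  have hq1 : 0 < q - 1 := Nat.sub_pos_of_lt hq.one_lt
  have hmul := (Nat.le_div_iff_mul_le hq1).mp hle
  have hpow := Nat.pow_pos (n := sInf {r : ℕ | 0 < r ∧ ∃ f, IsNondegMapK p q n r f}) hq.pos
  rw [mul_comm]
  omega
end

section
/- Let p be a prime and let Γ be a finite simple graph with chromatic number γ(Γ) ≥ 1. Then the least positive integer r such that Γ admits a proper vertex coloring with (p^r − 1)/(p − 1) colors (equivalently, such that there exists a nondegenerate simplicial map from Γ to K(F_p^r), since the 1-skeleton of K(F_p^r) is a complete graph on (p^r − 1)/(p − 1) vertices) equals ⌈log_p((p − 1)·γ(Γ) + 1)⌉. Consequently, if Γ has m vertices, its F_p-Buchstaber invariant is s_{F_p}(Γ) = m − ⌈log_p((p − 1)·γ(Γ) + 1)⌉. -/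
theorem colorable_geomSum_iff_clog_le {V : Type*} {Γ : SimpleGraph V} {b γ r : ℕ} (hb : 1 < b)
    (hγ : Γ.chromaticNumber = (γ : ℕ∞)) :
    Γ.Colorable ((b ^ r - 1) / (b - 1)) ↔ Nat.clog b ((b - 1) * γ + 1) ≤ r := by
  rw [← SimpleGraph.chromaticNumber_le_iff_colorable, hγ, Nat.cast_le,
    Nat.le_div_iff_mul_le (Nat.sub_pos_of_lt hb), Nat.clog_le_iff_le_pow hb, mul_comm γ,
    Nat.le_sub_iff_add_le (Nat.one_le_pow _ _ (zero_lt_one.trans hb))]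

/-- For a finite simple graph `Γ` with chromatic number `γ ≥ 1`, the least positive `r`
such that `Γ` admits a proper coloring with `(p^r − 1)/(p − 1)` colors (equivalently,
such that there is a nondegenerate simplicial map `Γ → K(F_p^r)`, since the 1-skeleton of
`K(F_p^r)` is the complete graph on its `(p^r − 1)/(p − 1)` vertices) equals
`⌈log_p((p − 1)γ + 1)⌉`; hence the `F_p`-Buchstaber invariant of `Γ` on `m` vertices is
`s_{F_p}(Γ) = m − ⌈log_p((p − 1)γ + 1)⌉`. -/
theorem buchstaber_Fp_graph {V : Type} [Fintype V] (p : ℕ) (hp : p.Prime)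
    (Γ : SimpleGraph V) (γ : ℕ) (hγ : Γ.chromaticNumber = (γ : ℕ∞)) (hγ1 : 1 ≤ γ) :
    sInf {r : ℕ | 0 < r ∧ Γ.Colorable ((p ^ r - 1) / (p - 1))} =
      Nat.clog p ((p - 1) * γ + 1) ∧
    Fintype.card V - sInf {r : ℕ | 0 < r ∧ Γ.Colorable ((p ^ r - 1) / (p - 1))} =
      Fintype.card V - Nat.clog p ((p - 1) * γ + 1) := by
  suffices h : sInf {r : ℕ | 0 < r ∧ Γ.Colorable ((p ^ r - 1) / (p - 1))} =
      Nat.clog p ((p - 1) * γ + 1) from ⟨h, by rw [h]⟩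
  have hset : {r : ℕ | 0 < r ∧ Γ.Colorable ((p ^ r - 1) / (p - 1))} =
      Set.Ici (Nat.clog p ((p - 1) * γ + 1)) := by
    ext r
    have hpos : 0 < Nat.clog p ((p - 1) * γ + 1) :=
      Nat.clog_pos hp.one_lt (Nat.succ_le_succ (Nat.mul_pos (Nat.sub_pos_of_lt hp.one_lt) hγ1))
    rw [Set.mem_ofPred_eq, Set.mem_Ici, colorable_geomSum_iff_clog_le hp.one_lt hγ]
    exact ⟨And.right, fun h => ⟨hpos.trans_le h, h⟩⟩
  rw [hset, csInf_Ici]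
end
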